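/- For every real number ŷ, the map x ↦ M(x − ŷ) is a bijection from the integers ℤ onto the nonnegative integers. -/

import Mathlib

open Classical in
/-- The generalized Rice mapping of a real residual. -/
noncomputable def riceMap (e : ℝ) : ℤ := if 0 ≤ e then ⌊2 * e⌋ else -⌊2 * e⌋ - 1

/-- On `x - y` with `x` an integer, the Rice mapping depends only on the integer
`2 * x + ⌊-2 * y⌋`. -/
theorem riceMap_intCast_sub (x : ℤ) (y : ℝ) :
    riceMap ((x : ℝ) - y) =
      if 0 ≤ 2 * x + ⌊-2 * y⌋ then 2 * x + ⌊-2 * y⌋ else -(2 * x + ⌊-2 * y⌋) - 1 := by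
  have hfloor : ⌊2 * ((x : ℝ) - y)⌋ = 2 * x + ⌊-2 * y⌋ := by
    rw [← Int.floor_intCast_add]
    congr 1
    push_cast
    ring
  have hsign : 0 ≤ (x : ℝ) - y ↔ 0 ≤ 2 * x + ⌊-2 * y⌋ := by
    rw [← hfloor, Int.floor_nonneg]
    constructor <;> intro h <;> linarith
  simp only [riceMap, hfloor, hsign]

/-- for every real `ŷ`, `x ↦ M(x − ŷ)` is a bijection from `ℤ` onto the
nonnegative integers. -/
theorem riceMap_bijective (yhat : ℝ) :
    Set.BijOn (fun x : ℤ => riceMap ((x : ℝ) - yhat)) Set.univ {n : ℤ | 0 ≤ n} := by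
  simp only [riceMap_intCast_sub]
  generalize ⌊-2 * yhat⌋ = k
  refine ⟨fun x _ => ?_, fun x _ z _ h => ?_, fun n hn => ?_⟩
  · simp only [Set.mem_ofPred_eq]
    split_ifs <;> omega
  · simp only at h
    split_ifs at h <;> omega
  · simp only [Set.mem_ofPred_eq] at hn
    simp only [Set.image_univ, Set.mem_range]
    rcases Int.emod_two_eq_zero_or_one (n - k) with h | h
    · refine ⟨(n - k) / 2, ?_⟩
      split_ifs <;> omega
    · refine ⟨(-n - 1 - k) / 2, ?_⟩
      split_ifs <;> omega
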